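/- arXiv:1602.00473 — 2 statements merged into one kernel-verified Lean document; each statement's English description precedes it below -/
import Mathlib

section
/- Let X be a Banach space. If f : [0,1] → X is variationally Henstock integrable, then f is variationally ℋ-integrable: the gauges in the definition of the variational Henstock integral of f can be taken to be Lebesgue measurable. -/
open Set Metric MeasureTheory Pointwise
open scoped ENNReal NNReal

namespace GaugePaper

variable (X : Type*) [NormedAddCommGroup X] [NormedSpace ℝ X]

/-- `A ∈ cwk(X)`: `A` is a nonempty, convex and weakly compact subset of `X`. -/
def IsCWK (A : Set X) : Prop :=
  A.Nonempty ∧ Convex ℝ A ∧ IsCompact (toWeakSpace ℝ X '' A)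

variable {X}

/-- The support function `σ(x*, A)`. -/
noncomputable def suppFn (x' : X →L[ℝ] ℝ) (A : Set X) : ℝ := sSup (x' '' A)

/-- `‖A‖ = sup {‖x‖ : x ∈ A}`. -/
noncomputable def setNorm (A : Set X) : ℝ := sSup ((fun x => ‖x‖) '' A)

/-- A gauge on `[0,1]`: a positive function. -/
def IsGauge (δ : ℝ → ℝ) : Prop := ∀ t ∈ Icc (0:ℝ) 1, 0 < δ t

/-- A tagged partition of `[0,1]` into `n` (possibly degenerate) nonoverlapping closed
subintervals `[pt i, pt (i+1)]`, with tags `tag i ∈ [0,1]`. -/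
structure TP (n : ℕ) where
  pt : Fin (n + 1) → ℝ
  tag : Fin n → ℝ
  mono : Monotone pt
  first : pt 0 = 0
  last : pt (Fin.last n) = 1
  tagMem : ∀ i, tag i ∈ Icc (0:ℝ) 1

namespace TP

variable {n : ℕ} (P : TP n)

/-- The `i`-th subinterval of the partition. -/
def ivl (i : Fin n) : Set ℝ := Icc (P.pt i.castSucc) (P.pt i.succ)

/-- The length `|I_i|` of the `i`-th subinterval. -/
def len (i : Fin n) : ℝ := P.pt i.succ - P.pt i.castSucc

/-- A Perron (Henstock) partition: each tag belongs to its interval. -/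
def IsPerron : Prop := ∀ i, P.tag i ∈ P.ivl i

/-- `δ`-fineness: `I_i ⊆ (t_i - δ(t_i), t_i + δ(t_i))`. -/
def IsFine (δ : ℝ → ℝ) : Prop :=
  ∀ i, P.ivl i ⊆ Ioo (P.tag i - δ (P.tag i)) (P.tag i + δ (P.tag i))

/-- An interior Henstock partition: each tag is in the interior of its interval, except
possibly for intervals containing `0` or `1`, where the tag may also be `0` or `1`. -/
def IsInterior : Prop :=
  ∀ i, P.tag i ∈ Ioo (P.pt i.castSucc) (P.pt i.succ) ∨
    (((0:ℝ) ∈ P.ivl i ∨ (1:ℝ) ∈ P.ivl i) ∧ P.tag i ∈ P.ivl i ∩ ({0, 1} : Set ℝ))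

end TP

/-- Riemann sum of a multifunction: `∑ i |I_i| • Γ(t_i)` (Minkowski sums). -/
def mSum {n : ℕ} (P : TP n) (Γ : ℝ → Set X) : Set X :=
  ∑ i : Fin n, P.len i • Γ (P.tag i)

/-- Riemann sum of a function: `∑ i |I_i| • f(t_i)`. -/
def fSum {n : ℕ} (P : TP n) (f : ℝ → X) : X :=
  ∑ i : Fin n, P.len i • f (P.tag i)

/-! ### Gauge integrals of multifunctions -/

/-- Henstock integrability of a multifunction `Γ : [0,1] → cwk(X)`. -/
def HenstockIntegrable (Γ : ℝ → Set X) : Prop :=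
  ∃ I : Set X, IsCWK X I ∧ ∀ ε > 0, ∃ δ : ℝ → ℝ, IsGauge δ ∧
    ∀ (n : ℕ) (P : TP n), P.IsPerron → P.IsFine δ → hausdorffDist I (mSum P Γ) < ε

/-- McShane integrability of a multifunction (free tags). -/
def McShaneIntegrable (Γ : ℝ → Set X) : Prop :=
  ∃ I : Set X, IsCWK X I ∧ ∀ ε > 0, ∃ δ : ℝ → ℝ, IsGauge δ ∧
    ∀ (n : ℕ) (P : TP n), P.IsFine δ → hausdorffDist I (mSum P Γ) < ε

/-- `ℋ`-integrability: Henstock integrability with Lebesgue measurable gauges. -/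
def HMeasIntegrable (Γ : ℝ → Set X) : Prop :=
  ∃ I : Set X, IsCWK X I ∧ ∀ ε > 0, ∃ δ : ℝ → ℝ, IsGauge δ ∧ AEMeasurable δ volume ∧
    ∀ (n : ℕ) (P : TP n), P.IsPerron → P.IsFine δ → hausdorffDist I (mSum P Γ) < ε

/-- Birkhoff (`ℳ`-) integrability: McShane integrability with Lebesgue measurable gauges. -/
def BirkhoffIntegrable (Γ : ℝ → Set X) : Prop :=
  ∃ I : Set X, IsCWK X I ∧ ∀ ε > 0, ∃ δ : ℝ → ℝ, IsGauge δ ∧ AEMeasurable δ volume ∧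
    ∀ (n : ℕ) (P : TP n), P.IsFine δ → hausdorffDist I (mSum P Γ) < ε

/-! ### Gauge integrals of (single-valued) functions -/

/-- Henstock integrability of a function `f : [0,1] → X`. -/
def FHenstockIntegrable (f : ℝ → X) : Prop :=
  ∃ w : X, ∀ ε > 0, ∃ δ : ℝ → ℝ, IsGauge δ ∧
    ∀ (n : ℕ) (P : TP n), P.IsPerron → P.IsFine δ → ‖w - fSum P f‖ < ε

/-- McShane integrability of a function. -/
def FMcShaneIntegrable (f : ℝ → X) : Prop :=
  ∃ w : X, ∀ ε > 0, ∃ δ : ℝ → ℝ, IsGauge δ ∧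
    ∀ (n : ℕ) (P : TP n), P.IsFine δ → ‖w - fSum P f‖ < ε

/-- `ℋ`-integrability of a function: measurable gauges. -/
def FHMeasIntegrable (f : ℝ → X) : Prop :=
  ∃ w : X, ∀ ε > 0, ∃ δ : ℝ → ℝ, IsGauge δ ∧ AEMeasurable δ volume ∧
    ∀ (n : ℕ) (P : TP n), P.IsPerron → P.IsFine δ → ‖w - fSum P f‖ < ε

/-- Birkhoff (`ℳ`-) integrability of a function: McShane with measurable gauges. -/
def FBirkhoffIntegrable (f : ℝ → X) : Prop :=
  ∃ w : X, ∀ ε > 0, ∃ δ : ℝ → ℝ, IsGauge δ ∧ AEMeasurable δ volume ∧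
    ∀ (n : ℕ) (P : TP n), P.IsFine δ → ‖w - fSum P f‖ < ε

/-- Henstock–Kurzweil integrability of a real-valued function on `[0,1]`. -/
def HKIntegrable (g : ℝ → ℝ) : Prop :=
  ∃ A : ℝ, ∀ ε > 0, ∃ δ : ℝ → ℝ, IsGauge δ ∧
    ∀ (n : ℕ) (P : TP n), P.IsPerron → P.IsFine δ → |fSum P g - A| < ε

/-! ### Pettis integrals -/

/-- Pettis integrability of a function `f : [0,1] → X`. -/
def FPettisIntegrable (f : ℝ → X) : Prop :=
  (∀ x' : X →L[ℝ] ℝ, IntegrableOn (fun t => x' (f t)) (Icc (0:ℝ) 1) volume) ∧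
  ∀ E ⊆ Icc (0:ℝ) 1, NullMeasurableSet E volume →
    ∃ ν : X, ∀ x' : X →L[ℝ] ℝ, x' ν = ∫ t in E, x' (f t)

/-- Pettis integrability of a multifunction `Γ : [0,1] → cwk(X)`. -/
def PettisIntegrable (Γ : ℝ → Set X) : Prop :=
  (∀ x' : X →L[ℝ] ℝ, IntegrableOn (fun t => suppFn x' (Γ t)) (Icc (0:ℝ) 1) volume) ∧
  ∀ E ⊆ Icc (0:ℝ) 1, NullMeasurableSet E volume →
    ∃ W : Set X, IsCWK X W ∧ ∀ x' : X →L[ℝ] ℝ, suppFn x' W = ∫ t in E, suppFn x' (Γ t)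

/-- `f` is a selection of `Γ`. -/
def Selection (Γ : ℝ → Set X) (f : ℝ → X) : Prop := ∀ t ∈ Icc (0:ℝ) 1, f t ∈ Γ t

/-! ### Variational integrals -/

/-- Finite additivity of an interval multifunction on subintervals of `[0,1]`
(an interval `[a,b] ⊆ [0,1]` is encoded by its endpoints). -/
def AdditiveIntervalMF (Φ : ℝ → ℝ → Set X) : Prop :=
  ∀ a b c : ℝ, 0 ≤ a → a ≤ b → b ≤ c → c ≤ 1 → Φ a c = Φ a b + Φ b c

/-- Finite additivity of a vector-valued interval function on subintervals of `[0,1]`. -/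
def AdditiveIntervalF (Φ : ℝ → ℝ → X) : Prop :=
  ∀ a b c : ℝ, 0 ≤ a → a ≤ b → b ≤ c → c ≤ 1 → Φ a c = Φ a b + Φ b c

/-- `Φ` is a variational Henstock primitive of the multifunction `Γ`. -/
def vHPrimitive (Γ : ℝ → Set X) (Φ : ℝ → ℝ → Set X) : Prop :=
  (∀ a b : ℝ, 0 ≤ a → a ≤ b → b ≤ 1 → IsCWK X (Φ a b)) ∧ AdditiveIntervalMF Φ ∧
  ∀ ε > 0, ∃ δ : ℝ → ℝ, IsGauge δ ∧ ∀ (n : ℕ) (P : TP n), P.IsPerron → P.IsFine δ →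
    ∑ i : Fin n, hausdorffDist (Φ (P.pt i.castSucc) (P.pt i.succ)) (P.len i • Γ (P.tag i)) < ε

/-- Variational Henstock integrability of a multifunction. -/
def vHIntegrable (Γ : ℝ → Set X) : Prop := ∃ Φ : ℝ → ℝ → Set X, vHPrimitive Γ Φ

/-- Variational McShane integrability of a multifunction (free tags). -/
def vMSIntegrable (Γ : ℝ → Set X) : Prop :=
  ∃ Φ : ℝ → ℝ → Set X,
    (∀ a b : ℝ, 0 ≤ a → a ≤ b → b ≤ 1 → IsCWK X (Φ a b)) ∧ AdditiveIntervalMF Φ ∧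
    ∀ ε > 0, ∃ δ : ℝ → ℝ, IsGauge δ ∧ ∀ (n : ℕ) (P : TP n), P.IsFine δ →
      ∑ i : Fin n, hausdorffDist (Φ (P.pt i.castSucc) (P.pt i.succ)) (P.len i • Γ (P.tag i)) < ε

/-- Variational `ℋ`-integrability of a multifunction: measurable gauges. -/
def vHMeasIntegrable (Γ : ℝ → Set X) : Prop :=
  ∃ Φ : ℝ → ℝ → Set X,
    (∀ a b : ℝ, 0 ≤ a → a ≤ b → b ≤ 1 → IsCWK X (Φ a b)) ∧ AdditiveIntervalMF Φ ∧
    ∀ ε > 0, ∃ δ : ℝ → ℝ, IsGauge δ ∧ AEMeasurable δ volume ∧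
      ∀ (n : ℕ) (P : TP n), P.IsPerron → P.IsFine δ →
        ∑ i : Fin n, hausdorffDist (Φ (P.pt i.castSucc) (P.pt i.succ)) (P.len i • Γ (P.tag i)) < ε

/-- `Φ` is a variational Henstock primitive of the function `f`. -/
def FvHPrimitive (f : ℝ → X) (Φ : ℝ → ℝ → X) : Prop :=
  AdditiveIntervalF Φ ∧
  ∀ ε > 0, ∃ δ : ℝ → ℝ, IsGauge δ ∧ ∀ (n : ℕ) (P : TP n), P.IsPerron → P.IsFine δ →
    ∑ i : Fin n, ‖Φ (P.pt i.castSucc) (P.pt i.succ) - P.len i • f (P.tag i)‖ < ε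

/-- Variational Henstock integrability of a function. -/
def FvHIntegrable (f : ℝ → X) : Prop := ∃ Φ : ℝ → ℝ → X, FvHPrimitive f Φ

/-- Variational McShane integrability of a function (free tags). -/
def FvMSIntegrable (f : ℝ → X) : Prop :=
  ∃ Φ : ℝ → ℝ → X, AdditiveIntervalF Φ ∧
    ∀ ε > 0, ∃ δ : ℝ → ℝ, IsGauge δ ∧ ∀ (n : ℕ) (P : TP n), P.IsFine δ →
      ∑ i : Fin n, ‖Φ (P.pt i.castSucc) (P.pt i.succ) - P.len i • f (P.tag i)‖ < ε

/-- Variational `ℋ`-integrability of a function: measurable gauges. -/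
def FvHMeasIntegrable (f : ℝ → X) : Prop :=
  ∃ Φ : ℝ → ℝ → X, AdditiveIntervalF Φ ∧
    ∀ ε > 0, ∃ δ : ℝ → ℝ, IsGauge δ ∧ AEMeasurable δ volume ∧
      ∀ (n : ℕ) (P : TP n), P.IsPerron → P.IsFine δ →
        ∑ i : Fin n, ‖Φ (P.pt i.castSucc) (P.pt i.succ) - P.len i • f (P.tag i)‖ < ε

/-! ### Partial Perron partitions and variational measures -/

/-- A finite tagged Perron family of `n` nonoverlapping closed subintervals
`[a i, b i]` of `[0,1]` (a "partition in `[0,1]`", not necessarily covering it). -/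
structure PTP (n : ℕ) where
  a : Fin n → ℝ
  b : Fin n → ℝ
  tag : Fin n → ℝ
  le : ∀ i, a i ≤ b i
  sub : ∀ i, Icc (a i) (b i) ⊆ Icc (0:ℝ) 1
  nonoverlap : ∀ i j, i ≠ j → (Icc (a i) (b i) ∩ Icc (a j) (b j)).Subsingleton
  perron : ∀ i, tag i ∈ Icc (a i) (b i)

/-- `δ`-fineness of a partial Perron family. -/
def PTP.IsFine {n : ℕ} (P : PTP n) (δ : ℝ → ℝ) : Prop :=
  ∀ i, Icc (P.a i) (P.b i) ⊆ Ioo (P.tag i - δ (P.tag i)) (P.tag i + δ (P.tag i))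

/-- `Var(Ψ, δ, E)` for a scalar interval function `Ψ`. -/
noncomputable def scVar (Ψ : ℝ → ℝ → ℝ) (δ : ℝ → ℝ) (E : Set ℝ) : ℝ≥0∞ :=
  ⨆ (n : ℕ) (P : PTP n) (_ : P.IsFine δ ∧ ∀ i, P.tag i ∈ E),
    ∑ i : Fin n, ENNReal.ofReal |Ψ (P.a i) (P.b i)|

/-- The variational measure `V_Ψ(E)` generated by a scalar interval function `Ψ`. -/
noncomputable def scVarMeasure (Ψ : ℝ → ℝ → ℝ) (E : Set ℝ) : ℝ≥0∞ :=
  ⨅ (δ : ℝ → ℝ) (_ : IsGauge δ), scVar Ψ δ E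

/-! ### Partial Perron families and the Saks–Henstock lemma -/

/-- `FineSum δ g x s` means that `s` is the sum of the values `g u v t` over the intervals
`[u, v]`, with tags `t`, of some `δ`-fine Perron partition of `[0, x]`. -/
inductive FineSum (δ : ℝ → ℝ) (g : ℝ → ℝ → ℝ → ℝ) : ℝ → ℝ → Prop
  | zero : FineSum δ g 0 0
  | snoc {x t y s : ℝ} : FineSum δ g x s → x ≤ t → t ≤ y → t - δ t < x → y < t + δ t →
      FineSum δ g y (s + g x y t)

theorem FineSum.exists_seq {δ : ℝ → ℝ} {g : ℝ → ℝ → ℝ → ℝ} {x s : ℝ} (h : FineSum δ g x s) :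
    ∃ (n : ℕ) (pt tag : ℕ → ℝ), pt 0 = 0 ∧ pt n = x ∧
      (∀ i < n, pt i ≤ tag i ∧ tag i ≤ pt (i + 1) ∧ tag i - δ (tag i) < pt i ∧
        pt (i + 1) < tag i + δ (tag i)) ∧
      ∑ i ∈ Finset.range n, g (pt i) (pt (i + 1)) (tag i) = s := by
  induction h with
  | zero => exact ⟨0, fun _ => 0, fun _ => 0, rfl, rfl, by simp, by simp⟩
  | @snoc x t y s _ h1 h2 h3 h4 ih =>
    obtain ⟨n, pt, tag, h0, hn, hi, hs⟩ := ih
    refine ⟨n + 1, fun i => if i ≤ n then pt i else y, fun i => if i < n then tag i else t,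
      by simp [h0], by simp, ?_, ?_⟩
    · intro i hin
      rcases Nat.lt_succ_iff_lt_or_eq.1 hin with hlt | rfl
      · simpa [hlt, hlt.le, Nat.succ_le_iff] using hi i hlt
      · simpa [hn] using ⟨h1, h2, h3, h4⟩
    · rw [Finset.sum_range_succ, ← hs]
      congr 1
      · refine Finset.sum_congr rfl fun i hin => ?_
        have hlt := Finset.mem_range.1 hin
        simp [hlt, hlt.le]
      · simp [hn]

theorem FineSum.exists_partition {δ : ℝ → ℝ} {g : ℝ → ℝ → ℝ → ℝ} {s : ℝ}
    (h : FineSum δ g 1 s) :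
    ∃ (n : ℕ) (P : TP n), P.IsPerron ∧ P.IsFine δ ∧
      ∑ i : Fin n, g (P.pt i.castSucc) (P.pt i.succ) (P.tag i) = s := by
  obtain ⟨n, pt, tag, h0, hn, hi, hs⟩ := h.exists_seq
  have hmono : Monotone fun i : Fin (n + 1) => pt i :=
    Fin.monotone_iff_le_succ.2 fun i => (hi i i.2).1.trans (hi i i.2).2.1
  refine ⟨n, ⟨fun i => pt i, fun i => tag i, hmono, h0, hn, fun i => ⟨?_, ?_⟩⟩, ?_, ?_, ?_⟩
  · exact (h0.symm.le.trans (hmono (Fin.zero_le i.castSucc))).trans (hi i i.2).1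
  · exact ((hi i i.2).2.1.trans (hmono (Fin.le_last i.succ))).trans hn.le
  · exact fun i => ⟨(hi i i.2).1, (hi i i.2).2.1⟩
  · exact fun i => Icc_subset_Ioo (hi i i.2).2.2.1 (hi i i.2).2.2.2
  · rw [← hs]
    exact Fin.sum_univ_eq_sum_range (fun i => g (pt i) (pt (i + 1)) (tag i)) n

/-- Cousin's lemma. -/
theorem FineSum.exists_extend {δ : ℝ → ℝ} (hδ : IsGauge δ) {g : ℝ → ℝ → ℝ → ℝ}
    (hg : ∀ x y t, 0 ≤ g x y t) {x y s : ℝ} (h : FineSum δ g x s) (hx : 0 ≤ x) (hxy : x ≤ y)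
    (hy : y ≤ 1) : ∃ s', s ≤ s' ∧ FineSum δ g y s' := by
  set S : Set ℝ := {z | x ≤ z ∧ z ≤ y ∧ ∃ s', s ≤ s' ∧ FineSum δ g z s'} with hS
  have hxS : x ∈ S := ⟨le_rfl, hxy, s, le_rfl, h⟩
  have hbdd : BddAbove S := ⟨y, fun z hz => hz.2.1⟩
  set c := sSup S with hc
  have hxc : x ≤ c := le_csSup hbdd hxS
  have hcy : c ≤ y := csSup_le ⟨x, hxS⟩ fun z hz => hz.2.1
  have hδc : 0 < δ c := hδ c ⟨hx.trans hxc, hcy.trans hy⟩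
  obtain ⟨z, ⟨hxz, hzy, s', hss, hz⟩, hzc⟩ :=
    exists_lt_of_lt_csSup ⟨x, hxS⟩ (show c - δ c < sSup S by linarith)
  have hzc' : z ≤ c := le_csSup hbdd ⟨hxz, hzy, s', hss, hz⟩
  have hw : c ≤ min y (c + δ c / 2) := le_min hcy (by linarith)
  have hnew : FineSum δ g (min y (c + δ c / 2)) (s' + g z (min y (c + δ c / 2)) c) :=
    hz.snoc hzc' hw hzc ((min_le_right _ _).trans_lt (by linarith))
  have hle : s ≤ s' + g z (min y (c + δ c / 2)) c := hss.trans (le_add_of_nonneg_right (hg _ _ _))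
  have hwc : min y (c + δ c / 2) ≤ c :=
    le_csSup hbdd ⟨hxc.trans hw, min_le_left _ _, _, hle, hnew⟩
  have hwy : min y (c + δ c / 2) = y := by
    rcases min_choice y (c + δ c / 2) with h' | h'
    · exact h'
    · rw [h'] at hwc
      linarith
  rw [hwy] at hnew hle
  exact ⟨_, hle, hnew⟩

theorem FineSum.exists_sum_le {δ : ℝ → ℝ} (hδ : IsGauge δ) {g : ℝ → ℝ → ℝ → ℝ}
    (hg : ∀ x y t, 0 ≤ g x y t) {ι : Type*} (a b t : ι → ℝ) (s : Finset ι)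
    (hlt : ∀ i ∈ s, a i < b i) (ha : ∀ i ∈ s, 0 ≤ a i) (hat : ∀ i ∈ s, a i ≤ t i)
    (htb : ∀ i ∈ s, t i ≤ b i) (hfa : ∀ i ∈ s, t i - δ (t i) < a i)
    (hfb : ∀ i ∈ s, b i < t i + δ (t i))
    (hdisj : ∀ i ∈ s, ∀ j ∈ s, i ≠ j → b i ≤ a j ∨ b j ≤ a i)
    {y : ℝ} (hy0 : 0 ≤ y) (hy1 : y ≤ 1) (hy : ∀ i ∈ s, b i ≤ y) :
    ∃ σ, ∑ i ∈ s, g (a i) (b i) (t i) ≤ σ ∧ FineSum δ g y σ := by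
  classical
  induction s using Finset.induction_on_max_value a generalizing y with
  | empty => simpa using FineSum.zero.exists_extend hδ hg le_rfl hy0 hy1
  | insert i s his hmax ih =>
    simp only [Finset.forall_mem_insert] at hlt ha hat htb hfa hfb hy
    have hbi : ∀ j ∈ s, b j ≤ a i := fun j hj => by
      rcases hdisj i (by simp) j (by simp [hj]) (by rintro rfl; exact his hj) with h | h
      · linarith [hmax j hj, hlt.1]
      · exact h
    obtain ⟨σ, hσ, hF⟩ := ih hlt.2 ha.2 hat.2 htb.2 hfa.2 hfb.2
      (fun j hj k hk => hdisj j (by simp [hj]) k (by simp [hk])) ha.1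
      (by linarith [hlt.1, hy.1]) hbi
    obtain ⟨σ', hσ', hF'⟩ := (hF.snoc hat.1 htb.1 hfa.1 hfb.1).exists_extend hδ hg
      (by linarith [hlt.1, ha.1]) hy.1 hy1
    refine ⟨σ', ?_, hF'⟩
    rw [Finset.sum_insert his]
    linarith

/-- The Saks–Henstock lemma: the bound on sums over full partitions holds for partial ones. -/
theorem sum_lt_of_partial {δ : ℝ → ℝ} (hδ : IsGauge δ) {g : ℝ → ℝ → ℝ → ℝ}
    (hg : ∀ x y t, 0 ≤ g x y t) {ε : ℝ}
    (hε : ∀ (n : ℕ) (P : TP n), P.IsPerron → P.IsFine δ →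
      ∑ i : Fin n, g (P.pt i.castSucc) (P.pt i.succ) (P.tag i) < ε)
    {ι : Type*} (a b t : ι → ℝ) (s : Finset ι)
    (hlt : ∀ i ∈ s, a i < b i) (ha : ∀ i ∈ s, 0 ≤ a i) (hb : ∀ i ∈ s, b i ≤ 1)
    (hat : ∀ i ∈ s, a i ≤ t i) (htb : ∀ i ∈ s, t i ≤ b i)
    (hfa : ∀ i ∈ s, t i - δ (t i) < a i) (hfb : ∀ i ∈ s, b i < t i + δ (t i))
    (hdisj : ∀ i ∈ s, ∀ j ∈ s, i ≠ j → b i ≤ a j ∨ b j ≤ a i) :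
    ∑ i ∈ s, g (a i) (b i) (t i) < ε := by
  obtain ⟨σ, hσ, hF⟩ := FineSum.exists_sum_le hδ hg a b t s hlt ha hat htb hfa hfb hdisj
    zero_le_one le_rfl hb
  obtain ⟨n, P, hP, hP', hsum⟩ := hF.exists_partition
  exact hσ.trans_lt (hsum ▸ hε n P hP hP')

/-! ### The primitive as a point function -/

/-- The point function `t ↦ Φ [0, t]` of an interval function, extended to the line by constants. -/
noncomputable def pointFn (Φ : ℝ → ℝ → X) : ℝ → X :=
  IccExtend (zero_le_one' ℝ) fun t => Φ 0 t

theorem AdditiveIntervalF.pointFn_sub {Y : Type*} [NormedAddCommGroup Y] {Φ : ℝ → ℝ → Y} (hΦ : AdditiveIntervalF Φ)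
    {a b : ℝ} (ha : 0 ≤ a) (hab : a ≤ b) (hb : b ≤ 1) : pointFn Φ b - pointFn Φ a = Φ a b := by
  rw [pointFn, IccExtend_of_mem _ _ ⟨ha.trans hab, hb⟩, IccExtend_of_mem _ _ ⟨ha, hab.trans hb⟩,
    hΦ 0 a b le_rfl ha hab hb, add_sub_cancel_left]

theorem AdditiveIntervalF.norm_pointFn_sub {Φ : ℝ → ℝ → X} (hΦ : AdditiveIntervalF Φ) {s t : ℝ}
    (hs : s ∈ Icc (0 : ℝ) 1) (ht : t ∈ Icc (0 : ℝ) 1) (x : X) :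
    ‖pointFn Φ s - pointFn Φ t - (s - t) • x‖ =
      ‖Φ (min s t) (max s t) - (max s t - min s t) • x‖ := by
  rcases le_total s t with h | h
  · rw [min_eq_left h, max_eq_right h, ← hΦ.pointFn_sub hs.1 h ht.2, ← norm_neg]
    congr 1
    module
  · rw [min_eq_right h, max_eq_left h, ← hΦ.pointFn_sub ht.1 h hs.2]

theorem sum_norm_pointFn_sub_lt {f : ℝ → X} {Φ : ℝ → ℝ → X} (hΦ : AdditiveIntervalF Φ) {ε : ℝ}
    {δ : ℝ → ℝ} (hδ : IsGauge δ)
    (hε : ∀ (n : ℕ) (P : TP n), P.IsPerron → P.IsFine δ →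
      ∑ i : Fin n, ‖Φ (P.pt i.castSucc) (P.pt i.succ) - P.len i • f (P.tag i)‖ < ε)
    (u : Finset ℝ) (σ : ℝ → ℝ) (hu : ∀ t ∈ u, t ∈ Icc (0 : ℝ) 1)
    (hσ : ∀ t ∈ u, σ t ∈ Icc (0 : ℝ) 1) (hne : ∀ t ∈ u, σ t ≠ t)
    (hfine : ∀ t ∈ u, |σ t - t| < δ t)
    (hdisj : ∀ t ∈ u, ∀ t' ∈ u, t ≠ t' → Disjoint (uIcc (σ t) t) (uIcc (σ t') t')) :
    ∑ t ∈ u, ‖pointFn Φ (σ t) - pointFn Φ t - (σ t - t) • f t‖ < ε := by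
  rw [Finset.sum_congr rfl fun t ht => hΦ.norm_pointFn_sub (hσ t ht) (hu t ht) (f t)]
  refine sum_lt_of_partial hδ (g := fun x y t => ‖Φ x y - (y - x) • f t‖)
    (fun _ _ _ => norm_nonneg _) hε (fun t => min (σ t) t) (fun t => max (σ t) t) id u
    (fun t ht => min_lt_max.2 (hne t ht)) (fun t ht => le_min (hσ t ht).1 (hu t ht).1)
    (fun t ht => max_le (hσ t ht).2 (hu t ht).2) (fun t _ => min_le_right _ _)
    (fun t _ => le_max_right _ _) (fun t ht => ?_) (fun t ht => ?_) (fun t ht t' ht' htt => ?_)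
  · have := abs_lt.1 (hfine t ht)
    exact lt_min (by simp; linarith) (by simp; linarith [abs_nonneg (σ t - t), hfine t ht])
  · have := abs_lt.1 (hfine t ht)
    exact max_lt (by simp; linarith) (by simp; linarith [abs_nonneg (σ t - t), hfine t ht])
  · by_contra! hcon
    have hmem : max (min (σ t) t) (min (σ t') t') ∈ uIcc (σ t) t :=
      ⟨le_max_left _ _, max_le min_le_max hcon.1.le⟩
    exact Set.disjoint_left.1 (hdisj t ht t' ht' htt) hmem
      ⟨le_max_right _ _, max_le hcon.2.le min_le_max⟩

theorem FvHPrimitive.continuous_pointFn {f : ℝ → X} {Φ : ℝ → ℝ → X} (h : FvHPrimitive f Φ) :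
    Continuous (pointFn Φ) := by
  have hon : ContinuousOn (pointFn Φ) (Icc 0 1) := by
    rw [Metric.continuousOn_iff]
    intro t ht ε hε
    obtain ⟨δ, hδ, hP⟩ := h.2 (ε / 2) (by positivity)
    have hpos : 0 < ε / (2 * (‖f t‖ + 1)) := by positivity
    refine ⟨min (δ t) (ε / (2 * (‖f t‖ + 1))), lt_min (hδ t ht) hpos, fun s hs hst => ?_⟩
    rcases eq_or_ne s t with rfl | hne
    · simpa using hε
    rw [Real.dist_eq, lt_min_iff, lt_div_iff₀ (by positivity)] at hst
    have := sum_norm_pointFn_sub_lt h.1 hδ hP {t} (fun _ => s) (by simpa using ht)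
      (by simpa using hs) (by simpa using hne) (by simpa using hst.1)
      (by simp +contextual)
    rw [Finset.sum_singleton] at this
    rw [dist_eq_norm]
    calc ‖pointFn Φ s - pointFn Φ t‖
        ≤ ‖pointFn Φ s - pointFn Φ t - (s - t) • f t‖ + ‖(s - t) • f t‖ := norm_le_norm_sub_add _ _
      _ < ε := by
        rw [norm_smul, Real.norm_eq_abs]
        nlinarith [abs_nonneg (s - t), norm_nonneg (f t)]
  refine Continuous.Icc_extend' ?_
  refine (continuousOn_iff_continuous_domRestrict.1 hon).congr fun t => ?_
  simp [pointFn]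

/-! ### The primitive is differentiable almost everywhere -/

/-- The points `t` of `(0, 1)` near which the difference quotients of `G` at `t`
deviate from `f t` by more than `η`. -/
def deviationSet (G f : ℝ → X) (η : ℝ) : Set ℝ :=
  {t ∈ Ioo (0 : ℝ) 1 | ∀ r > 0, ∃ s, |s - t| < r ∧ η * |s - t| < ‖G s - G t - (s - t) • f t‖}

theorem uIcc_eq_closedBall (s t : ℝ) : uIcc s t = closedBall ((s + t) / 2) (|s - t| / 2) := by
  rcases le_total s t with h | h
  · rw [uIcc_of_le h, Real.Icc_eq_closedBall, abs_of_nonpos (by linarith), neg_sub]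
  · rw [uIcc_of_ge h, Real.Icc_eq_closedBall, abs_of_nonneg (by linarith), add_comm]

theorem FvHPrimitive.volume_deviationSet {f : ℝ → X} {Φ : ℝ → ℝ → X} (h : FvHPrimitive f Φ)
    {η : ℝ} (hη : 0 < η) : volume (deviationSet (pointFn Φ) f η) = 0 := by
  set B := deviationSet (pointFn Φ) f η with hB
  refine le_antisymm (ENNReal.le_of_forall_pos_le_add fun e he _ => ?_) zero_le
  obtain ⟨δ, hδ, hP⟩ := h.2 (η * e / 5) (by positivity)
  have hBI : ∀ t ∈ B, t ∈ Icc (0 : ℝ) 1 := fun t ht => Ioo_subset_Icc_self ht.1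
  have hσ : ∀ t ∈ B, ∃ s, |s - t| < min (δ t) (min t (1 - t)) ∧
      η * |s - t| < ‖pointFn Φ s - pointFn Φ t - (s - t) • f t‖ := fun t ht =>
    ht.2 _ (lt_min (hδ t (hBI t ht)) (lt_min ht.1.1 (sub_pos.2 ht.1.2)))
  choose! σ hσlt hσdev using hσ
  simp only [lt_min_iff] at hσlt
  have hσI : ∀ t ∈ B, σ t ∈ Icc (0 : ℝ) 1 := fun t ht => by
    have h1 := abs_lt.1 (hσlt t ht).2.1
    have h2 := abs_lt.1 (hσlt t ht).2.2
    constructor <;> linarith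
  have hne : ∀ t ∈ B, σ t ≠ t := fun t ht heq => by
    have := hσdev t ht
    simp [heq] at this
  obtain ⟨u, huB, hdisj, hcov⟩ := Vitali.exists_disjoint_subfamily_covering_enlargement_closedBall
    B (fun t => (σ t + t) / 2) (fun t => |σ t - t| / 2) 1
    (fun t ht => by linarith [(hσlt t ht).2.1, ht.1.2]) 5 (by norm_num)
  have hcount : u.Countable := hdisj.countable_of_nonempty_interior fun t ht => by
    rw [interior_closedBall _ (by simpa [sub_eq_zero] using hne t (huB ht)), nonempty_ball]
    simpa [sub_eq_zero] using hne t (huB ht)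
  have hsub : B ⊆ ⋃ t ∈ u, closedBall ((σ t + t) / 2) (5 * (|σ t - t| / 2)) := fun t ht => by
    obtain ⟨b, hb, hb'⟩ := hcov t ht
    refine mem_biUnion hb (hb' ?_)
    rw [← uIcc_eq_closedBall]
    exact right_mem_uIcc
  calc volume B ≤ ∑' t : u, volume (closedBall ((σ t + t) / 2) (5 * (|σ t - t| / 2))) :=
        (measure_mono hsub).trans (measure_biUnion_le _ hcount _)
    _ ≤ 0 + e := by
      rw [zero_add]
      refine ENNReal.summable.tsum_le_of_sum_le fun F => ?_
      have hsum := sum_norm_pointFn_sub_lt h.1 hδ hP (F.map (Function.Embedding.subtype _)) σ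
        (by simpa using fun t ht _ => hBI t (huB ht)) (by simpa using fun t ht _ => hσI t (huB ht))
        (by simpa using fun t ht _ => hne t (huB ht))
        (by simpa using fun t ht _ => (hσlt t (huB ht)).1)
        (by
          simp only [uIcc_eq_closedBall]
          intro t ht t' ht' htt
          simp only [Finset.mem_map, Function.Embedding.subtype_apply, Subtype.exists,
            exists_and_right, exists_eq_right] at ht ht'
          exact hdisj ht.1 ht'.1 htt)
      rw [Finset.sum_map] at hsum
      simp only [Function.Embedding.subtype_apply] at hsum
      have hle : η * ∑ t ∈ F, |σ t - t| ≤ η * e / 5 := by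
        rw [Finset.mul_sum]
        exact (Finset.sum_le_sum fun (t : u) _ => (hσdev t (huB t.2)).le).trans hsum.le
      have hle' : ∑ t ∈ F, |σ t - (t : ℝ)| ≤ e / 5 := by
        rw [mul_div_assoc] at hle
        exact le_of_mul_le_mul_left hle hη
      simp only [Real.volume_closedBall]
      rw [← ENNReal.ofReal_sum_of_nonneg (fun _ _ => by positivity), ← ENNReal.ofReal_coe_nnreal]
      refine ENNReal.ofReal_le_ofReal ?_
      calc ∑ t ∈ F, 2 * (5 * (|σ t - (t : ℝ)| / 2)) = 5 * ∑ t ∈ F, |σ t - (t : ℝ)| := by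
            rw [Finset.mul_sum]
            exact Finset.sum_congr rfl fun _ _ => by ring
        _ ≤ e := by linarith

theorem FvHPrimitive.volume_not_hasDerivAt {f : ℝ → X} {Φ : ℝ → ℝ → X} (h : FvHPrimitive f Φ) :
    volume {t ∈ Icc (0 : ℝ) 1 | ¬HasDerivAt (pointFn Φ) (f t) t} = 0 := by
  have hsub : {t ∈ Icc (0 : ℝ) 1 | ¬HasDerivAt (pointFn Φ) (f t) t} ⊆
      {0, 1} ∪ ⋃ k : ℕ, deviationSet (pointFn Φ) f (1 / ((k : ℝ) + 1)) := by
    rintro t ⟨ht, hd⟩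
    by_cases h01 : t ∈ ({0, 1} : Set ℝ)
    · exact Or.inl h01
    refine Or.inr ?_
    simp only [mem_insert_iff, mem_singleton_iff, not_or] at h01
    rw [hasDerivAt_iff_isLittleO, Asymptotics.isLittleO_iff] at hd
    push Not at hd
    obtain ⟨c, hc, hfreq⟩ := hd
    obtain ⟨k, hk⟩ := exists_nat_one_div_lt hc
    refine mem_iUnion.2 ⟨k, ⟨lt_of_le_of_ne ht.1 (Ne.symm h01.1), lt_of_le_of_ne ht.2 h01.2⟩,
      fun r hr => ?_⟩
    obtain ⟨s, hs, hsr⟩ := (hfreq.and_eventually (ball_mem_nhds t hr)).exists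
    rw [Real.dist_eq] at hsr
    refine ⟨s, hsr, lt_of_le_of_lt ?_ hs⟩
    rw [Real.norm_eq_abs]
    gcongr
  refine measure_mono_null hsub (measure_union_null ?_ (measure_iUnion_null fun k =>
    h.volume_deviationSet (by positivity)))
  exact (Set.toFinite _).measure_zero _

/-! ### A measurable gauge at the points of differentiability -/

/-- The points at which the difference quotients of `G` with increments smaller than `r`
differ from each other by at most `ε`. -/
def oscSet (G : ℝ → X) (ε r : ℝ) : Set ℝ :=
  {t | ∀ s s', |s - t| < r → |s' - t| < r →
    ‖(s' - t) • (G s - G t) - (s - t) • (G s' - G t)‖ ≤ ε * (|s - t| * |s' - t|)}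

theorem isClosed_oscSet {G : ℝ → X} (hG : Continuous G) (ε r : ℝ) : IsClosed (oscSet G ε r) := by
  simp only [oscSet, ofPred_forall]
  refine isClosed_iInter fun s => isClosed_iInter fun s' => ?_
  exact isClosed_imp (isOpen_lt (by fun_prop) (by fun_prop))
    (isClosed_imp (isOpen_lt (by fun_prop) (by fun_prop))
      (isClosed_le (by fun_prop) (by fun_prop)))

theorem exists_mem_oscSet {G : ℝ → X} {x : X} {t : ℝ} (h : HasDerivAt G x t) {ε : ℝ}
    (hε : 0 < ε) : ∃ n : ℕ, t ∈ oscSet G ε (1 / ((n : ℝ) + 1)) := by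
  rw [hasDerivAt_iff_isLittleO, Asymptotics.isLittleO_iff] at h
  obtain ⟨r, hr, hball⟩ := Metric.eventually_nhds_iff.1 (h (half_pos hε))
  obtain ⟨n, hn⟩ := exists_nat_one_div_lt hr
  refine ⟨n, fun s s' hs hs' => ?_⟩
  have h1 := hball (y := s) (by rw [Real.dist_eq]; linarith)
  have h2 := hball (y := s') (by rw [Real.dist_eq]; linarith)
  rw [Real.norm_eq_abs] at h1 h2
  calc ‖(s' - t) • (G s - G t) - (s - t) • (G s' - G t)‖
      = ‖(s' - t) • (G s - G t - (s - t) • x) - (s - t) • (G s' - G t - (s' - t) • x)‖ := by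
        congr 1
        module
    _ ≤ |s' - t| * (ε / 2 * |s - t|) + |s - t| * (ε / 2 * |s' - t|) := by
        refine (norm_sub_le _ _).trans ?_
        rw [norm_smul, norm_smul, Real.norm_eq_abs, Real.norm_eq_abs]
        gcongr
    _ = ε * (|s - t| * |s' - t|) := by ring

theorem norm_sub_le_of_mem_oscSet {G : ℝ → X} {x : X} {t : ℝ} (h : HasDerivAt G x t)
    {ε r : ℝ} (ht : t ∈ oscSet G ε r) {s : ℝ} (hs : |s - t| < r) :
    ‖G s - G t - (s - t) • x‖ ≤ ε * |s - t| := by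
  have hlim : Filter.Tendsto (fun s' => G s - G t - (s - t) • ((s' - t)⁻¹ • (G s' - G t)))
      (nhdsWithin t {t}ᶜ) (nhds (G s - G t - (s - t) • x)) := by
    have := hasDerivAt_iff_tendsto_slope.1 h
    exact tendsto_const_nhds.sub (this.const_smul (s - t))
  refine le_of_tendsto hlim.norm ?_
  have hnear : ∀ᶠ s' in nhdsWithin t {t}ᶜ, |s' - t| < r :=
    nhdsWithin_le_nhds (ball_mem_nhds t ((abs_nonneg _).trans_lt hs))
  filter_upwards [hnear, self_mem_nhdsWithin] with s' hs' hne
  have hne' : s' - t ≠ 0 := sub_ne_zero.2 hne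
  have hpos : 0 < |s' - t| := abs_pos.2 hne'
  have := ht s s' hs hs'
  refine le_of_mul_le_mul_left (a := |s' - t|) ?_ hpos
  calc |s' - t| * ‖G s - G t - (s - t) • ((s' - t)⁻¹ • (G s' - G t))‖
      = ‖(s' - t) • (G s - G t) - (s - t) • (G s' - G t)‖ := by
        rw [← Real.norm_eq_abs, ← norm_smul, smul_sub, smul_comm (s' - t) (s - t),
          smul_inv_smul₀ hne']
    _ ≤ |s' - t| * (ε * |s - t|) := by linarith

/-- A Borel measurable function serves as gauge at all points of differentiability. -/
theorem exists_measurable_gauge {G : ℝ → X} (hG : Continuous G) {ε : ℝ} (hε : 0 < ε) :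
    ∃ δ : ℝ → ℝ, Measurable δ ∧ (∀ t, 0 < δ t) ∧
      ∀ t x, HasDerivAt G x t → ∀ s, |s - t| < δ t → ‖G s - G t - (s - t) • x‖ ≤ ε * |s - t| := by
  classical
  set A : ℕ → Set ℝ := fun n => oscSet G ε (1 / ((n : ℝ) + 1)) with hA
  have hmeas : ∀ n, MeasurableSet (A n) := fun n => (isClosed_oscSet hG _ _).measurableSet
  have hex : ∀ t, ∃ n, t ∈ A n ∪ (⋃ k, A k)ᶜ := fun t => by
    by_cases ht : t ∈ ⋃ k, A k
    · obtain ⟨n, hn⟩ := mem_iUnion.1 ht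
      exact ⟨n, Or.inl hn⟩
    · exact ⟨0, Or.inr ht⟩
  have hfind : Measurable fun t => Nat.find (hex t) :=
    measurable_find hex fun n => (hmeas n).union (MeasurableSet.iUnion hmeas).compl
  refine ⟨fun t => 1 / ((Nat.find (hex t) : ℝ) + 1), ?_, fun t => by positivity, ?_⟩
  · exact (measurable_from_nat (f := fun n : ℕ => 1 / ((n : ℝ) + 1))).comp hfind
  · intro t x hx s hs
    refine norm_sub_le_of_mem_oscSet hx ?_ hs
    exact (Nat.find_spec (hex t)).resolve_right fun hc =>
      hc (mem_iUnion.2 (exists_mem_oscSet hx hε))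

theorem TP.sum_len {n : ℕ} (P : TP n) : ∑ i : Fin n, P.len i = 1 := by
  have h1 := Fin.sum_univ_succ P.pt
  have h2 := Fin.sum_univ_castSucc P.pt
  rw [P.first] at h1
  rw [P.last] at h2
  simp only [TP.len, Finset.sum_sub_distrib]
  linarith

theorem AdditiveIntervalF.norm_sub_smul_le {Φ : ℝ → ℝ → X} (hΦ : AdditiveIntervalF Φ)
    {a b t ε r : ℝ} {x : X} (ha : 0 ≤ a) (hat : a ≤ t) (htb : t ≤ b) (hb : b ≤ 1) (hra : t - r < a)
    (hrb : b < t + r)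
    (h : ∀ s, |s - t| < r → ‖pointFn Φ s - pointFn Φ t - (s - t) • x‖ ≤ ε * |s - t|) :
    ‖Φ a b - (b - a) • x‖ ≤ ε * (b - a) := by
  have h1 := h a (abs_lt.2 ⟨by linarith, by linarith⟩)
  have h2 := h b (abs_lt.2 ⟨by linarith, by linarith⟩)
  rw [abs_of_nonpos (by linarith)] at h1
  rw [abs_of_nonneg (by linarith)] at h2
  calc ‖Φ a b - (b - a) • x‖
      = ‖(pointFn Φ b - pointFn Φ t - (b - t) • x)
          - (pointFn Φ a - pointFn Φ t - (a - t) • x)‖ := by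
        rw [← hΦ.pointFn_sub ha (hat.trans htb) hb]
        congr 1
        module
    _ ≤ ε * (b - a) := (norm_sub_le _ _).trans (by linarith)

/-- Theorem `cinquesei` of the paper. Every variationally Henstock
integrable function `f : [0,1] → X` is variationally `ℋ`-integrable: the gauges in the
definition of the variational Henstock integral can be taken Lebesgue measurable. -/
theorem fvH_implies_fvHMeas
    {X : Type*} [NormedAddCommGroup X] [NormedSpace ℝ X] [CompleteSpace X]
    (f : ℝ → X) (hf : FvHIntegrable f) : FvHMeasIntegrable f := by
  classical
  obtain ⟨Φ, h⟩ := hf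
  refine ⟨Φ, h.1, fun ε hε => ?_⟩
  obtain ⟨δ₀, hδ₀, hP₀⟩ := h.2 (ε / 3) (by positivity)
  obtain ⟨δ₁, hδ₁m, hδ₁, hder⟩ :=
    exists_measurable_gauge h.continuous_pointFn (show 0 < ε / 3 by positivity)
  set N : Set ℝ := {t ∈ Icc (0 : ℝ) 1 | ¬HasDerivAt (pointFn Φ) (f t) t} with hN
  refine ⟨N.piecewise δ₀ δ₁, fun t ht => ?_, ⟨δ₁, hδ₁m, ?_⟩, fun n P hP hfine => ?_⟩
  · by_cases htN : t ∈ N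
    · simpa [htN] using hδ₀ t ht
    · simpa [htN] using hδ₁ t
  · filter_upwards [compl_mem_ae_iff.2 h.volume_not_hasDerivAt] with t ht
    exact piecewise_eq_of_notMem _ _ _ ht
  have hle : ∀ i : Fin n, P.pt i.castSucc ≤ P.pt i.succ := fun i =>
    P.mono i.castSucc_lt_succ.le
  have h0 : ∀ i, 0 ≤ P.pt i := fun i => P.first.symm.le.trans (P.mono (Fin.zero_le i))
  have h1 : ∀ i, P.pt i ≤ 1 := fun i => (P.mono (Fin.le_last i)).trans P.last.le
  have hfa := fun i => (hfine i (left_mem_Icc.2 (hle i))).1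
  have hfb := fun i => (hfine i (right_mem_Icc.2 (hle i))).2
  set T : Finset (Fin n) := {i | P.tag i ∈ N ∧ P.pt i.castSucc < P.pt i.succ} with hT
  have hTN : ∀ i ∈ T, P.tag i ∈ N := fun i hi => (Finset.mem_filter.1 hi).2.1
  have hexc : ∑ i ∈ T, ‖Φ (P.pt i.castSucc) (P.pt i.succ) - P.len i • f (P.tag i)‖ < ε / 3 := by
    refine sum_lt_of_partial hδ₀ (g := fun x y t => ‖Φ x y - (y - x) • f t‖)
      (fun _ _ _ => norm_nonneg _) hP₀ (fun i => P.pt i.castSucc) (fun i => P.pt i.succ) P.tag T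
      (fun i hi => (Finset.mem_filter.1 hi).2.2) (fun i _ => h0 _) (fun i _ => h1 _)
      (fun i _ => (hP i).1) (fun i _ => (hP i).2) (fun i hi => ?_) (fun i hi => ?_)
      fun i _ j _ hij => ?_
    · simpa [hTN i hi] using hfa i
    · simpa [hTN i hi] using hfb i
    · rcases lt_or_gt_of_ne hij with hlt | hlt
      · exact Or.inl (P.mono (Fin.succ_le_castSucc_iff.2 hlt))
      · exact Or.inr (P.mono (Fin.succ_le_castSucc_iff.2 hlt))
  have hbound : ∀ i, ‖Φ (P.pt i.castSucc) (P.pt i.succ) - P.len i • f (P.tag i)‖ ≤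
      (if i ∈ T then ‖Φ (P.pt i.castSucc) (P.pt i.succ) - P.len i • f (P.tag i)‖ else 0) +
        ε / 3 * P.len i := by
    intro i
    have hlen : 0 ≤ ε / 3 * P.len i := mul_nonneg (by positivity) (sub_nonneg.2 (hle i))
    by_cases hi : i ∈ T
    · simpa [hi] using hlen
    rw [if_neg hi, zero_add]
    by_cases htN : P.tag i ∈ N
    · have heq : P.pt i.castSucc = P.pt i.succ := (hle i).eq_of_not_lt fun hlt =>
        hi (by simp [hT, htN, hlt])
      have hΦ0 := h.1.pointFn_sub (h0 i.succ) le_rfl (h1 i.succ)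
      rw [sub_self] at hΦ0
      simp [TP.len, heq, ← hΦ0]
    · have hd : HasDerivAt (pointFn Φ) (f (P.tag i)) (P.tag i) := by
        by_contra hd
        exact htN ⟨P.tagMem i, hd⟩
      refine h.1.norm_sub_smul_le (h0 _) (hP i).1 (hP i).2 (h1 _) (r := δ₁ (P.tag i)) ?_ ?_
        (hder _ _ hd)
      · simpa [htN] using hfa i
      · simpa [htN] using hfb i
  calc ∑ i : Fin n, ‖Φ (P.pt i.castSucc) (P.pt i.succ) - P.len i • f (P.tag i)‖
      ≤ ∑ i ∈ T, ‖Φ (P.pt i.castSucc) (P.pt i.succ) - P.len i • f (P.tag i)‖ + ε / 3 := by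
        refine (Finset.sum_le_sum fun i _ => hbound i).trans_eq ?_
        rw [Finset.sum_add_distrib, ← Finset.mul_sum, P.sum_len, mul_one]
        simp
    _ < ε := by linarith

end GaugePaper
end

section
/- Let X be a Banach space. If a multifunction Γ : [0,1] → cwk(X) is variationally Henstock integrable, then Γ is variationally ℋ-integrable: the gauges in the definition of the variational Henstock integral of Γ can be taken to be Lebesgue measurable. -/
open Set Metric MeasureTheory Pointwise
open scoped ENNReal NNReal

namespace GaugePaper

variable (X : Type*) [NormedAddCommGroup X] [NormedSpace ℝ X]

variable {X}

open scoped Topology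

/-- `FineSum δ g a b s`: the interval `[a, b]` has a `δ`-fine Perron partition, listed from left to
right, over which `g` (a function of the two endpoints and of the tag) sums to `s`. -/
inductive FineSum_s19 (δ : ℝ → ℝ) (g : ℝ → ℝ → ℝ → ℝ) : ℝ → ℝ → ℝ → Prop
  | nil (a : ℝ) : FineSum_s19 δ g a a 0
  | cons {a b c t s : ℝ} (hat : a ≤ t) (htb : t ≤ b) (ha : t - δ t < a) (hb : b < t + δ t)
      (h : FineSum_s19 δ g b c s) : FineSum_s19 δ g a c (g a b t + s)

namespace FineSum_s19

variable {δ : ℝ → ℝ} {g : ℝ → ℝ → ℝ → ℝ} {a b c s s' t : ℝ}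

theorem le (h : FineSum_s19 δ g a b s) : a ≤ b := by
  induction h with
  | nil => exact le_rfl
  | cons hat htb _ _ _ ih => exact hat.trans (htb.trans ih)

theorem append (h : FineSum_s19 δ g a b s) (h' : FineSum_s19 δ g b c s') : FineSum_s19 δ g a c (s + s') := by
  induction h with
  | nil => simpa using h'
  | cons hat htb ha hb _ ih => rw [add_assoc]; exact cons hat htb ha hb (ih h')

theorem single (hat : a ≤ t) (htb : t ≤ b) (ha : t - δ t < a) (hb : b < t + δ t) :
    FineSum_s19 δ g a b (g a b t) := by
  simpa using cons (g := g) hat htb ha hb (nil b)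

theorem nonneg (hg : ∀ a b t, 0 ≤ g a b t) (h : FineSum_s19 δ g a b s) : 0 ≤ s := by
  induction h with
  | nil => exact le_rfl
  | cons _ _ _ _ _ ih => exact add_nonneg (hg _ _ _) ih

/-- Cousin's lemma. -/
theorem exists_of_le (g : ℝ → ℝ → ℝ → ℝ) (hab : a ≤ b) (hδ : ∀ t ∈ Icc a b, 0 < δ t) :
    ∃ s, FineSum_s19 δ g a b s := by
  set S : Set ℝ := {x | x ∈ Icc a b ∧ ∃ s, FineSum_s19 δ g a x s} with hS
  have haS : a ∈ S := ⟨left_mem_Icc.2 hab, 0, nil a⟩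
  have hbdd : BddAbove S := ⟨b, fun x hx => hx.1.2⟩
  set t := sSup S with ht
  have hat : a ≤ t := le_csSup hbdd haS
  have htb : t ≤ b := csSup_le ⟨a, haS⟩ fun x hx => hx.1.2
  have hδt := hδ t ⟨hat, htb⟩
  obtain ⟨x, ⟨hx, s, hs⟩, hxt⟩ := exists_lt_of_lt_csSup ⟨a, haS⟩ (sub_lt_self t hδt)
  have hxle : x ≤ t := le_csSup hbdd ⟨hx, s, hs⟩
  have hyS : min b (t + δ t / 2) ∈ S :=
    ⟨⟨le_min hab (by linarith), min_le_left _ _⟩, _,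
      hs.append (single hxle (le_min htb (by linarith)) hxt
        ((min_le_right _ _).trans_lt (by linarith)))⟩
  have hle := le_csSup hbdd hyS
  rcases le_total b (t + δ t / 2) with h | h
  · rw [min_eq_left h] at hyS
    exact hyS.2
  · rw [min_eq_right h] at hle
    linarith

theorem exists_partition_s19 (h : FineSum_s19 δ g a b s) :
    ∃ (n : ℕ) (pt : Fin (n + 1) → ℝ) (tag : Fin n → ℝ), pt 0 = a ∧ pt (Fin.last n) = b ∧
      (∀ i : Fin n, tag i ∈ Icc (pt i.castSucc) (pt i.succ) ∧
        Icc (pt i.castSucc) (pt i.succ) ⊆ Ioo (tag i - δ (tag i)) (tag i + δ (tag i))) ∧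
      ∑ i : Fin n, g (pt i.castSucc) (pt i.succ) (tag i) = s := by
  induction h with
  | nil a => exact ⟨0, fun _ => a, Fin.elim0, rfl, rfl, fun i => i.elim0, by simp⟩
  | @cons a b c t s hat htb ha hb _ ih =>
    obtain ⟨n, pt, tag, h0, h1, h2, h3⟩ := ih
    refine ⟨n + 1, Fin.cons a pt, Fin.cons t tag, rfl, ?_, ?_, ?_⟩
    · rw [← Fin.succ_last, Fin.cons_succ, h1]
    · intro i
      refine Fin.cases ?_ (fun i => ?_) i
      · simp only [Fin.castSucc_zero, Fin.cons_zero, Fin.cons_succ, h0]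
        exact ⟨⟨hat, htb⟩, fun x hx => ⟨ha.trans_le hx.1, hx.2.trans_lt hb⟩⟩
      · simpa only [← Fin.succ_castSucc, Fin.cons_succ] using h2 i
    · rw [Fin.sum_univ_succ]
      simp only [Fin.castSucc_zero, Fin.cons_zero, Fin.cons_succ, ← Fin.succ_castSucc, h0, h3]

/-- A bound on all full `δ`-fine Perron sums over `[0,1]` in terms of `TP`. -/
theorem lt_of_forall_TP {C : ℝ}
    (H : ∀ (n : ℕ) (P : TP n), P.IsPerron → P.IsFine δ →
      ∑ i : Fin n, g (P.pt i.castSucc) (P.pt i.succ) (P.tag i) < C)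
    (h : FineSum_s19 δ g 0 1 s) : s < C := by
  obtain ⟨n, pt, tag, h0, h1, h2, rfl⟩ := h.exists_partition_s19
  have hm : Monotone pt := Fin.monotone_iff_le_succ.2 fun i => (h2 i).1.1.trans (h2 i).1.2
  exact H n ⟨pt, tag, hm, h0, h1, fun i =>
    ⟨h0 ▸ (hm (Fin.zero_le _)).trans (h2 i).1.1, h1 ▸ (h2 i).1.2.trans (hm (Fin.le_last _))⟩⟩
    (fun i => (h2 i).1) fun i => (h2 i).2

/-- The intervals of a Perron partition whose tags satisfy `p`, if they are `δ`-fine, extend to a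
`δ`-fine Perron partition of `[0,1]`. -/
theorem exists_ge_sum_filter (hδ : IsGauge δ) (hg : ∀ a b t, 0 ≤ g a b t) {n : ℕ} (P : TP n)
    (hP : P.IsPerron) (p : Fin n → Prop) [DecidablePred p]
    (hfine : ∀ i, p i → P.ivl i ⊆ Ioo (P.tag i - δ (P.tag i)) (P.tag i + δ (P.tag i))) :
    ∃ s, FineSum_s19 δ g 0 1 s ∧
      ∑ i with p i, g (P.pt i.castSucc) (P.pt i.succ) (P.tag i) ≤ s := by
  have hI : ∀ i, P.pt i ∈ Icc (0 : ℝ) 1 := fun i =>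
    ⟨P.first ▸ P.mono (Fin.zero_le _), P.last ▸ P.mono (Fin.le_last _)⟩
  have key : ∀ k : Fin (n + 1), ∃ s, FineSum_s19 δ g 0 (P.pt k) s ∧
      ∑ i with p i ∧ i.castSucc < k, g (P.pt i.castSucc) (P.pt i.succ) (P.tag i) ≤ s := by
    intro k
    induction k using Fin.induction with
    | zero => exact ⟨0, by rw [P.first]; exact nil 0, by simp⟩
    | succ k ih =>
      obtain ⟨s, hs, hle⟩ := ih
      have hlt : ∀ i : Fin n, i.castSucc < k.succ ↔ i = k ∨ i.castSucc < k.castSucc := by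
        intro i
        simp only [Fin.lt_def, Fin.ext_iff, Fin.val_castSucc, Fin.val_succ]
        omega
      by_cases hk : p k
      · have hsub := hfine k hk
        have hmk := hP k
        have hle' := hmk.1.trans hmk.2
        refine ⟨_, hs.append (single hmk.1 hmk.2 (hsub (left_mem_Icc.2 hle')).1
          (hsub (right_mem_Icc.2 hle')).2), ?_⟩
        have : (Finset.univ.filter fun i => p i ∧ i.castSucc < k.succ) =
            insert k (Finset.univ.filter fun i => p i ∧ i.castSucc < k.castSucc) := by
          ext i
          simp only [Finset.mem_filter, Finset.mem_univ, true_and, Finset.mem_insert, hlt]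
          grind
        rw [this, Finset.sum_insert (by simp)]
        linarith
      · obtain ⟨s', hs'⟩ := exists_of_le (δ := δ) g (P.mono k.castSucc_le_succ) fun t ht =>
          hδ t ⟨(hI _).1.trans ht.1, ht.2.trans (hI _).2⟩
        refine ⟨_, hs.append hs', ?_⟩
        have : (Finset.univ.filter fun i => p i ∧ i.castSucc < k.succ) =
            Finset.univ.filter fun i => p i ∧ i.castSucc < k.castSucc := by
          ext i
          simp only [Finset.mem_filter, Finset.mem_univ, true_and, hlt]
          grind
        rw [this]
        linarith [hs'.nonneg hg]
  obtain ⟨s, hs, hle⟩ := key (Fin.last n)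
  refine ⟨s, P.last ▸ hs, ?_⟩
  simpa [Fin.castSucc_lt_last] using hle

/-- A finite disjoint family of `δ`-fine tagged intervals in `[x, y]`, given as triples
(left endpoint, right endpoint, tag), extends to a `δ`-fine Perron partition of `[x, y]`. -/
theorem exists_ge_sum_disjoint (hg : ∀ a b t, 0 ≤ g a b t) {x : ℝ} (F : Finset (ℝ × ℝ × ℝ)) :
    ∀ y, x ≤ y → (∀ t ∈ Icc x y, 0 < δ t) →
      (F : Set (ℝ × ℝ × ℝ)).PairwiseDisjoint (fun q => Icc q.1 q.2.1) →
      (∀ q ∈ F, x ≤ q.1 ∧ q.2.1 ≤ y ∧ q.1 ≤ q.2.2 ∧ q.2.2 ≤ q.2.1 ∧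
        q.2.2 - δ q.2.2 < q.1 ∧ q.2.1 < q.2.2 + δ q.2.2) →
      ∃ s, FineSum_s19 δ g x y s ∧ ∑ q ∈ F, g q.1 q.2.1 q.2.2 ≤ s := by
  classical
  induction F using Finset.induction_on_max_value (fun q : ℝ × ℝ × ℝ => q.2.1) with
  | empty =>
    intro y hxy hδ _ _
    obtain ⟨s, hs⟩ := exists_of_le g hxy hδ
    exact ⟨s, hs, by simpa using hs.nonneg hg⟩
  | insert m F hm hmax ih =>
    intro y hxy hδ hdisj hF
    obtain ⟨h1, h2, h3, h4, h5, h6⟩ := hF m (Finset.mem_insert_self _ _)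
    rw [Finset.coe_insert] at hdisj
    obtain ⟨s, hs, hle⟩ := ih m.1 h1 (fun t ht => hδ t ⟨ht.1, by linarith [ht.2]⟩)
      (hdisj.subset (Set.subset_insert _ _)) fun q hq => by
        obtain ⟨q1, q2, q3, q4, q5, q6⟩ := hF q (Finset.mem_insert_of_mem hq)
        refine ⟨q1, ?_, q3, q4, q5, q6⟩
        by_contra! hlt
        have hqm : q ≠ m := fun h => hm (h ▸ hq)
        exact Set.disjoint_left.1 (hdisj (Set.mem_insert_of_mem _ hq) (Set.mem_insert _ _) hqm)
          (show q.2.1 ∈ Icc q.1 q.2.1 from ⟨q3.trans q4, le_rfl⟩) ⟨hlt.le, hmax q hq⟩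
    obtain ⟨s', hs'⟩ := exists_of_le (δ := δ) g h2 fun t ht => hδ t ⟨by linarith [ht.1], ht.2⟩
    refine ⟨_, (hs.append (single h3 h4 h5 h6)).append hs', ?_⟩
    rw [Finset.sum_insert hm]
    linarith [hs'.nonneg hg]

end FineSum_s19

/-- The points `t` of `[0,1]` such that `g a b t ≤ η (b - a)` for all intervals `[a, b]` of `[0,1]`
containing `t` and contained in the ball of radius `1 / (k + 1)` around `t`. -/
def goodPts (g : ℝ → ℝ → ℝ → ℝ) (η : ℝ) (k : ℕ) : Set ℝ :=
  {t | t ∈ Icc (0 : ℝ) 1 ∧ ∀ a b, 0 ≤ a → a < b → b ≤ 1 → t ∈ Icc a b →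
    t - 1 / ((k : ℝ) + 1) < a → b < t + 1 / ((k : ℝ) + 1) → g a b t ≤ η * (b - a)}

/-- An interval function with zero variation is differentiable with derivative zero almost
everywhere. -/
theorem volume_forall_notMem_goodPts {g : ℝ → ℝ → ℝ → ℝ} (hg : ∀ a b t, 0 ≤ g a b t)
    (hvar : ∀ ε > 0, ∃ δ : ℝ → ℝ, IsGauge δ ∧ ∀ s, FineSum_s19 δ g 0 1 s → s < ε)
    {η : ℝ} (hη : 0 < η) :
    volume {t | t ∈ Icc (0 : ℝ) 1 ∧ ∀ k, t ∉ goodPts g η k} = 0 := by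
  set E : Set ℝ := {t | t ∈ Icc (0 : ℝ) 1 ∧ ∀ k, t ∉ goodPts g η k} with hE
  refine le_antisymm (ENNReal.le_of_forall_pos_le_add fun ε hε _ => ?_) zero_le
  obtain ⟨δ, hδ, hs⟩ := hvar (ε * η) (mul_pos hε hη)
  set T : Set (ℝ × ℝ × ℝ) := {q | 0 ≤ q.1 ∧ q.1 < q.2.1 ∧ q.2.1 ≤ 1 ∧ q.1 ≤ q.2.2 ∧
    q.2.2 ≤ q.2.1 ∧ q.2.2 - δ q.2.2 < q.1 ∧ q.2.1 < q.2.2 + δ q.2.2 ∧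
    η * (q.2.1 - q.1) < g q.1 q.2.1 q.2.2} with hT
  obtain ⟨u, huT, hucount, hudisj, hunull⟩ := Vitali.exists_disjoint_covering_ae volume E T 6
    (fun q => q.2.1 - q.1) (fun q => q.2.2) (fun q => Icc q.1 q.2.1)
    (fun q ⟨_, _, _, h1, h2, _⟩ x hx => by
      rw [mem_closedBall, Real.dist_eq, abs_le]
      constructor <;> linarith [hx.1, hx.2])
    (fun q ⟨_, h, _⟩ => by
      have h6 : ((6 : ℝ≥0) : ℝ≥0∞) = ENNReal.ofReal 6 := by simp
      rw [Real.volume_closedBall, Real.volume_Icc, h6, ← ENNReal.ofReal_mul (by norm_num)]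
      exact ENNReal.ofReal_le_ofReal (by linarith))
    (fun q ⟨_, h, _⟩ => by rw [interior_Icc]; exact nonempty_Ioo.2 h)
    (fun q _ => isClosed_Icc)
    (fun x hx r hr => by
      have hδx := hδ x hx.1
      obtain ⟨k, hk⟩ := exists_nat_one_div_lt (lt_min hδx (half_pos hr))
      have h1 := hk.trans_le (min_le_left _ _)
      have h2 := hk.trans_le (min_le_right _ _)
      have := hx.2 k
      simp only [goodPts, mem_ofPred_eq, not_and, not_forall, not_le] at this
      obtain ⟨a, b, ha, hab, hb, hxab, h3, h4, h5⟩ := this hx.1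
      exact ⟨(a, b, x), ⟨ha, hab, hb, hxab.1, hxab.2, by simp only; linarith,
        by simp only; linarith, h5⟩, by simp only; linarith, rfl⟩)
  have hcover : volume E ≤ volume (E \ ⋃ q ∈ u, Icc q.1 q.2.1) +
      volume (⋃ q ∈ u, Icc q.1 q.2.1) :=
    (measure_mono (by rw [sdiff_union_self]; exact subset_union_left)).trans (measure_union_le _ _)
  rw [hunull, zero_add] at hcover
  rw [zero_add]
  refine hcover.trans ((measure_biUnion_le _ hucount _).trans
    (ENNReal.summable.tsum_le_of_sum_le fun F => ?_))
  set F' : Finset (ℝ × ℝ × ℝ) := F.map (Function.Embedding.subtype _) with hF'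
  have hF'u : ∀ q ∈ F', q ∈ u := fun q hq => by
    obtain ⟨p, _, rfl⟩ := Finset.mem_map.1 hq
    exact p.2
  obtain ⟨s, hs', hle⟩ := FineSum_s19.exists_ge_sum_disjoint (δ := δ) hg F' 1 zero_le_one
    hδ (hudisj.subset hF'u) fun q hq => by
      obtain ⟨h1, _, h2, h3, h4, h5, h6, _⟩ := huT (hF'u q hq)
      exact ⟨h1, h2, h3, h4, h5, h6⟩
  have hsum : ∑ p ∈ F, volume (Icc (p : ℝ × ℝ × ℝ).1 (p : ℝ × ℝ × ℝ).2.1) =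
      ENNReal.ofReal (∑ q ∈ F', (q.2.1 - q.1)) := by
    rw [ENNReal.ofReal_sum_of_nonneg fun q hq => sub_nonneg.2 (huT (hF'u q hq)).2.1.le,
      Finset.sum_map]
    simp [Real.volume_Icc]
  have hmul : η * ∑ q ∈ F', (q.2.1 - q.1) ≤ ∑ q ∈ F', g q.1 q.2.1 q.2.2 := by
    rw [Finset.mul_sum]
    exact Finset.sum_le_sum fun q hq => (huT (hF'u q hq)).2.2.2.2.2.2.2.le
  have hlt : ∑ q ∈ F', (q.2.1 - q.1) ≤ ε := by
    refine le_of_mul_le_mul_left ?_ hη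
    linarith [hs s hs']
  rw [hsum, ← ENNReal.ofReal_coe_nnreal]
  exact ENNReal.ofReal_le_ofReal hlt

/-- The points of the closure of `A` that are not limits of `A` from both sides. -/
def oneSidedPts (A : Set ℝ) : Set ℝ :=
  {x ∈ closure A | 𝓝[closure A ∩ Ioi x] x = ⊥} ∪ {x ∈ closure A | 𝓝[closure A ∩ Iio x] x = ⊥}

theorem countable_oneSidedPts (A : Set ℝ) : (oneSidedPts A).Countable :=
  countable_setOfPred_isolated_right_within.union countable_setOfPred_isolated_left_within

theorem exists_mem_Ioo_right {A : Set ℝ} {t c : ℝ} (ht : t ∈ closure A) (ht' : t ∉ oneSidedPts A)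
    (htc : t < c) : ∃ u ∈ A, t < u ∧ u < c := by
  have hne : (𝓝[closure A ∩ Ioi t] t).NeBot := ⟨fun h => ht' (Or.inl ⟨ht, h⟩)⟩
  have hmem : closure A ∩ Ioi t ∩ Iio c ∈ 𝓝[closure A ∩ Ioi t] t :=
    Filter.inter_mem self_mem_nhdsWithin (mem_nhdsWithin_of_mem_nhds (Iio_mem_nhds htc))
  obtain ⟨x, ⟨hx, hxt⟩, hxc⟩ := hne.nonempty_of_mem hmem
  obtain ⟨u, hu, huA⟩ := mem_closure_iff.1 hx (Ioo t c) isOpen_Ioo ⟨hxt, hxc⟩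
  exact ⟨u, huA, hu⟩

theorem exists_mem_Ioo_left {A : Set ℝ} {t c : ℝ} (ht : t ∈ closure A) (ht' : t ∉ oneSidedPts A)
    (hct : c < t) : ∃ u ∈ A, c < u ∧ u < t := by
  have hne : (𝓝[closure A ∩ Iio t] t).NeBot := ⟨fun h => ht' (Or.inr ⟨ht, h⟩)⟩
  have hmem : closure A ∩ Iio t ∩ Ioi c ∈ 𝓝[closure A ∩ Iio t] t :=
    Filter.inter_mem self_mem_nhdsWithin (mem_nhdsWithin_of_mem_nhds (Ioi_mem_nhds hct))
  obtain ⟨x, ⟨hx, hxt⟩, hxc⟩ := hne.nonempty_of_mem hmem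
  obtain ⟨u, hu, huA⟩ := mem_closure_iff.1 hx (Ioo c t) isOpen_Ioo ⟨hxc, hxt⟩
  exact ⟨u, huA, hu⟩

/-- At two-sided limits of `goodPts g η k` which are good at some scale, the scale `k` works. -/
theorem le_of_mem_closure_goodPts {g : ℝ → ℝ → ℝ → ℝ}
    (hcmp : ∀ a b c d t u, 0 ≤ a → a < b → b ≤ 1 → 0 ≤ c → c < d → d ≤ 1 → t ∈ Icc (0 : ℝ) 1 →
      u ∈ Icc (0 : ℝ) 1 → g a b t ≤ g a b u + (b - a) / (d - c) * (g c d u + g c d t))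
    {η t a b : ℝ} {k m : ℕ} (htm : t ∈ goodPts g η m) (htk : t ∈ closure (goodPts g η k))
    (ht : t ∉ oneSidedPts (goodPts g η k)) (ha : 0 ≤ a) (hab : a < b) (hb : b ≤ 1)
    (htab : t ∈ Icc a b) (h1 : t - 1 / ((k : ℝ) + 1) < a) (h2 : b < t + 1 / ((k : ℝ) + 1)) :
    g a b t ≤ 3 * η * (b - a) := by
  have hk : (0 : ℝ) < 1 / ((k : ℝ) + 1) := by positivity
  have hm : (0 : ℝ) < 1 / ((m : ℝ) + 1) := by positivity
  set rk := 1 / ((k : ℝ) + 1)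
  set rm := 1 / ((m : ℝ) + 1)
  have main : ∀ c d u, u ∈ goodPts g η k → 0 ≤ c → c < d → d ≤ 1 → g a b u ≤ η * (b - a) →
      g c d u ≤ η * (d - c) → g c d t ≤ η * (d - c) → g a b t ≤ 3 * η * (b - a) := by
    intro c d u hu hc hcd hd e1 e2 e3
    have e4 := hcmp a b c d t u ha hab hb hc hcd hd htm.1 hu.1
    have hdc : 0 < d - c := sub_pos.2 hcd
    have e5 : (b - a) / (d - c) * (g c d u + g c d t) ≤
        (b - a) / (d - c) * (2 * η * (d - c)) :=
      mul_le_mul_of_nonneg_left (by linarith) (div_pos (sub_pos.2 hab) hdc).le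
    have e6 : (b - a) / (d - c) * (2 * η * (d - c)) = 2 * η * (b - a) := by
      field_simp
    linarith
  rcases lt_or_ge t b with htb | hbt
  · obtain ⟨d, htd, hd⟩ := exists_between (lt_min htb (lt_min (lt_add_of_pos_right t hm)
      (lt_add_of_pos_right t hk)))
    simp only [lt_min_iff] at hd
    obtain ⟨u, hu, htu, hud⟩ := exists_mem_Ioo_right htk ht (c := min d (a + rk))
      (lt_min htd (by linarith))
    rw [lt_min_iff] at hud
    refine main t d u hu (ha.trans htab.1) htd (by linarith) ?_ ?_ ?_
    · exact hu.2 a b ha hab hb ⟨by linarith [htab.1], by linarith⟩ (by linarith) (by linarith)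
    · exact hu.2 t d (ha.trans htab.1) htd (by linarith) ⟨htu.le, hud.1.le⟩
        (by linarith [htab.1]) (by linarith)
    · exact htm.2 t d (ha.trans htab.1) htd (by linarith) ⟨le_rfl, htd.le⟩
        (by linarith) (by linarith)
  · have hat : a < t := hab.trans_le hbt
    obtain ⟨c, hc, hct⟩ := exists_between (max_lt hat (max_lt (sub_lt_self t hm)
      (sub_lt_self t hk)))
    simp only [max_lt_iff] at hc
    obtain ⟨u, hu, hcu, hut⟩ := exists_mem_Ioo_left htk ht (c := max c (b - rk))
      (max_lt hct (by linarith))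
    rw [max_lt_iff] at hcu
    refine main c t u hu (by linarith) hct (htab.2.trans hb) ?_ ?_ ?_
    · exact hu.2 a b ha hab hb ⟨by linarith, hut.le.trans htab.2⟩ (by linarith) (by linarith)
    · exact hu.2 c t (by linarith) hct (htab.2.trans hb) ⟨hcu.1.le, hut.le⟩
        (by linarith) (by linarith)
    · exact htm.2 c t (by linarith) hct (htab.2.trans hb) ⟨hct.le, le_rfl⟩
        (by linarith) (by linarith)

/-- If an interval function comparable across tags has zero variation, then the gauges witnessing
this can be taken measurable. -/
theorem exists_measurable_gauge_s19 {g : ℝ → ℝ → ℝ → ℝ} (hg : ∀ a b t, 0 ≤ g a b t)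
    (hdeg : ∀ a, 0 ≤ a → a ≤ 1 → g a a a = 0)
    (hcmp : ∀ a b c d t u, 0 ≤ a → a < b → b ≤ 1 → 0 ≤ c → c < d → d ≤ 1 → t ∈ Icc (0 : ℝ) 1 →
      u ∈ Icc (0 : ℝ) 1 → g a b t ≤ g a b u + (b - a) / (d - c) * (g c d u + g c d t))
    (hvar : ∀ ε > 0, ∃ δ : ℝ → ℝ, IsGauge δ ∧ ∀ s, FineSum_s19 δ g 0 1 s → s < ε)
    {ε : ℝ} (hε : 0 < ε) :
    ∃ δ : ℝ → ℝ, IsGauge δ ∧ AEMeasurable δ volume ∧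
      ∀ (n : ℕ) (P : TP n), P.IsPerron → P.IsFine δ →
        ∑ i : Fin n, g (P.pt i.castSucc) (P.pt i.succ) (P.tag i) < ε := by
  classical
  set η := ε / 8 with hη
  have hη0 : 0 < η := by positivity
  obtain ⟨δ₀, hδ₀, hs₀⟩ := hvar (ε / 2) (half_pos hε)
  set A := goodPts g η with hA
  set N : Set ℝ := {t | t ∈ Icc (0 : ℝ) 1 ∧ ∀ k, t ∉ A k} ∪ ⋃ k, oneSidedPts (A k) with hN
  have hN0 : volume N = 0 := measure_union_null (volume_forall_notMem_goodPts hg hvar hη0)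
    ((countable_iUnion fun k => countable_oneSidedPts _).measure_zero _)
  have hp : ∀ t, ∃ k, t ∈ closure (A k) ∨ t ∈ (⋃ j, closure (A j))ᶜ := by
    intro t
    by_cases h : t ∈ ⋃ j, closure (A j)
    · obtain ⟨k, hk⟩ := mem_iUnion.1 h
      exact ⟨k, Or.inl hk⟩
    · exact ⟨0, Or.inr h⟩
  have hmeas : Measurable fun t => Nat.find (hp t) := measurable_find hp fun k =>
    isClosed_closure.measurableSet.union
      (MeasurableSet.iUnion fun j => isClosed_closure.measurableSet).compl
  set δ₁ : ℝ → ℝ := fun t => 1 / ((Nat.find (hp t) : ℝ) + 1) with hδ₁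
  have hδ₁m : Measurable δ₁ :=
    (measurable_from_nat (f := fun k : ℕ => 1 / ((k : ℝ) + 1))).comp hmeas
  set δ : ℝ → ℝ := N.piecewise δ₀ δ₁ with hδ
  refine ⟨δ, fun t ht => ?_, ⟨δ₁, hδ₁m, ?_⟩, fun n P hP hfine => ?_⟩
  · by_cases h : t ∈ N
    · rw [hδ, piecewise_eq_of_mem _ _ _ h]
      exact hδ₀ t ht
    · rw [hδ, piecewise_eq_of_notMem _ _ _ h]
      simp only [hδ₁]
      positivity
  · filter_upwards [measure_eq_zero_iff_ae_notMem.1 hN0] with t ht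
    exact piecewise_eq_of_notMem _ _ _ ht
  · obtain ⟨s, hs, hle⟩ := FineSum_s19.exists_ge_sum_filter (g := g) hδ₀ hg P hP
      (fun i => P.tag i ∈ N) fun i hi => by
        have := hfine i
        rwa [hδ, piecewise_eq_of_mem _ _ _ hi] at this
    have hgood : ∀ i, P.tag i ∉ N →
        g (P.pt i.castSucc) (P.pt i.succ) (P.tag i) ≤ 3 * η * P.len i := by
      intro i hi
      have hmi := hP i
      have hsub := hfine i
      rw [hδ, piecewise_eq_of_notMem _ _ _ hi] at hsub
      have h0 : 0 ≤ P.pt i.castSucc := P.first ▸ P.mono (Fin.zero_le _)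
      have h1 : P.pt i.succ ≤ 1 := P.last ▸ P.mono (Fin.le_last _)
      have hle' := hmi.1.trans hmi.2
      simp only [hN, mem_union, mem_iUnion, not_or, not_exists, mem_ofPred_eq, not_and, not_forall,
        not_not] at hi
      obtain ⟨m, hm⟩ := hi.1 (P.tagMem i)
      rcases hle'.lt_or_eq with hlt | heq
      · have hk : P.tag i ∈ closure (A (Nat.find (hp (P.tag i)))) :=
          (Nat.find_spec (hp (P.tag i))).resolve_right fun h =>
            h (mem_iUnion.2 ⟨m, subset_closure hm⟩)
        exact le_of_mem_closure_goodPts hcmp hm hk (hi.2 _) h0 hlt h1 hmi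
          (hsub (left_mem_Icc.2 hle')).1 (hsub (right_mem_Icc.2 hle')).2
      · have ht : P.tag i = P.pt i.succ := le_antisymm hmi.2 (heq ▸ hmi.1)
        rw [TP.len, heq, ht, hdeg _ (heq ▸ h0) h1]
        simp
    have hlen : ∀ i, 0 ≤ P.len i := fun i => sub_nonneg.2 (P.mono i.castSucc_le_succ)
    have htot : ∑ i, P.len i = 1 := by
      have := (Fin.sum_univ_succ P.pt).symm.trans (Fin.sum_univ_castSucc P.pt)
      simp only [TP.len, Finset.sum_sub_distrib]
      linarith [P.first, P.last]
    have hrest : ∑ i with P.tag i ∉ N, g (P.pt i.castSucc) (P.pt i.succ) (P.tag i) ≤ 3 * η := by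
      calc _ ≤ ∑ i with P.tag i ∉ N, 3 * η * P.len i :=
            Finset.sum_le_sum fun i hi => hgood i (Finset.mem_filter.1 hi).2
        _ ≤ ∑ i, 3 * η * P.len i :=
            Finset.sum_le_sum_of_subset_of_nonneg (Finset.filter_subset _ _) fun i _ _ =>
              mul_nonneg (by positivity) (hlen i)
        _ = 3 * η := by rw [← Finset.mul_sum, htot, mul_one]
    rw [← Finset.sum_filter_add_sum_filter_not Finset.univ (fun i => P.tag i ∈ N)]
    linarith [hs₀ s hs]

/-- Weakly compact sets are bounded, by the uniform boundedness principle. -/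
theorem IsCWK.isBounded {X : Type*} [NormedAddCommGroup X] [NormedSpace ℝ X] {A : Set X}
    (hA : IsCWK X A) : Bornology.IsBounded A := by
  obtain ⟨C, hC⟩ := banach_steinhaus
    (g := fun x : A => NormedSpace.inclusionInDoubleDualLi (E := X) ℝ (x : X)) fun f => by
      have hf : Continuous fun x : WeakSpace ℝ X => f ((toWeakSpace ℝ X).symm x) :=
        WeakBilin.eval_continuous (topDualPairing ℝ X).flip f
      obtain ⟨C, hC⟩ := (hA.2.2.image hf).isBounded.exists_norm_le
      refine ⟨C, fun x => hC _ ⟨toWeakSpace ℝ X x, ⟨x, x.2, rfl⟩, ?_⟩⟩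
      simp [NormedSpace.inclusionInDoubleDualLi]
  refine isBounded_iff_forall_norm_le.2 ⟨C, fun x hx => ?_⟩
  simpa only [LinearIsometry.norm_map] using hC ⟨x, hx⟩

theorem eq_zero_of_bounded_of_eq_add_self {X : Type*} [NormedAddCommGroup X] [NormedSpace ℝ X]
    {A : Set X} (hne : A.Nonempty) (hb : Bornology.IsBounded A) (hA : A = A + A) : A = {0} := by
  refine hne.subset_singleton_iff.1 fun x hx => ?_
  obtain ⟨C, hC⟩ := hb.exists_norm_le
  have key : ∀ n : ℕ, ((n : ℝ) + 1) • x ∈ A := by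
    intro n
    induction n with
    | zero => simpa using hx
    | succ n ih =>
      rw [hA]
      exact ⟨_, ih, x, hx, by push_cast; module⟩
  by_contra hx0
  have hpos : 0 < ‖x‖ := norm_pos_iff.2 hx0
  obtain ⟨n, hn⟩ := exists_nat_gt (C / ‖x‖)
  have h1 := hC _ (key n)
  rw [norm_smul, Real.norm_of_nonneg (by positivity)] at h1
  rw [div_lt_iff₀ hpos] at hn
  nlinarith

theorem hausdorffDist_smul_le {X : Type*} [NormedAddCommGroup X] [NormedSpace ℝ X]
    {A B : Set X} (hfin : hausdorffEDist A B ≠ ⊤) {c : ℝ} (hc : 0 < c) :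
    hausdorffDist (c • A) (c • B) ≤ c * hausdorffDist A B := by
  refine le_of_forall_gt_imp_ge_of_dense fun r hr => ?_
  have hr' : hausdorffDist A B < r / c := by rwa [lt_div_iff₀ hc, mul_comm]
  have h0 : 0 ≤ r := (mul_nonneg hc.le hausdorffDist_nonneg).trans hr.le
  have hd : ∀ x y : X, dist x y < r / c → dist (c • x) (c • y) ≤ r := fun x y h => by
    rw [dist_smul₀, Real.norm_of_nonneg hc.le, mul_comm]
    exact ((lt_div_iff₀ hc).1 h).le
  refine hausdorffDist_le_of_mem_dist h0 ?_ ?_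
  · rintro _ ⟨x, hx, rfl⟩
    obtain ⟨y, hy, hxy⟩ := exists_dist_lt_of_hausdorffDist_lt hx hr' hfin
    exact ⟨c • y, smul_mem_smul_set hy, hd _ _ hxy⟩
  · rintro _ ⟨y, hy, rfl⟩
    obtain ⟨x, hx, hxy⟩ := exists_dist_lt_of_hausdorffDist_lt' hy hr' hfin
    exact ⟨c • x, smul_mem_smul_set hx, hd _ _ (by rwa [dist_comm])⟩

/-- Comparison of the approximation errors of a tag `t` on two intervals of lengths `l` and `m`,
through a second tag `u`: here `F`, `G` are the increments and `A`, `B` the values at `t`, `u`. -/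
theorem hausdorffDist_smul_le_add {X : Type*} [NormedAddCommGroup X] [NormedSpace ℝ X]
    {F G A B : Set X} (hF : IsCWK X F) (hG : IsCWK X G) (hA : IsCWK X A) (hB : IsCWK X B)
    {l m : ℝ} (hl : 0 < l) (hm : 0 < m) :
    hausdorffDist F (l • A) ≤ hausdorffDist F (l • B) +
      l / m * (hausdorffDist G (m • B) + hausdorffDist G (m • A)) := by
  have fin : ∀ {U V : Set X}, U.Nonempty → V.Nonempty → Bornology.IsBounded U →
      Bornology.IsBounded V → hausdorffEDist U V ≠ ⊤ := fun h1 h2 h3 h4 =>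
    hausdorffEDist_ne_top_of_nonempty_of_bounded h1 h2 h3 h4
  have h1 : hausdorffDist F (l • A) ≤ hausdorffDist F (l • B) + hausdorffDist (l • B) (l • A) :=
    hausdorffDist_triangle (fin hF.1 hB.1.smul_set hF.isBounded (hB.isBounded.smul₀ l))
  have h2 : hausdorffDist (m • B) (m • A) ≤
      hausdorffDist (m • B) G + hausdorffDist G (m • A) :=
    hausdorffDist_triangle (fin hB.1.smul_set hG.1 (hB.isBounded.smul₀ m) hG.isBounded)
  have h3 : hausdorffDist (l • B) (l • A) ≤ l / m * hausdorffDist (m • B) (m • A) := by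
    have := hausdorffDist_smul_le (fin hB.1.smul_set hA.1.smul_set (hB.isBounded.smul₀ m)
      (hA.isBounded.smul₀ m)) (div_pos hl hm)
    rwa [smul_smul, smul_smul, div_mul_cancel₀ _ hm.ne'] at this
  rw [hausdorffDist_comm] at h2
  rw [hausdorffDist_comm (s := m • B) (t := G)] at h2
  rw [hausdorffDist_comm (s := m • B) (t := m • A)] at h3
  have := mul_le_mul_of_nonneg_left h2 (div_pos hl hm).le
  linarith

/-- multivalued extension of Theorem `cinquesei` of the paper. Every
variationally Henstock integrable multifunction `Γ : [0,1] → cwk(X)` is variationally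
`ℋ`-integrable: the gauges in the definition of the variational Henstock integral can be
taken Lebesgue measurable. -/
theorem vH_implies_vHMeas
    {X : Type*} [NormedAddCommGroup X] [NormedSpace ℝ X] [CompleteSpace X]
    (Γ : ℝ → Set X) (hΓ : ∀ t ∈ Icc (0:ℝ) 1, IsCWK X (Γ t))
    (h : vHIntegrable Γ) : vHMeasIntegrable Γ := by
  obtain ⟨Φ, hΦ, hadd, hvar⟩ := h
  refine ⟨Φ, hΦ, hadd, fun ε hε => ?_⟩
  refine exists_measurable_gauge_s19 (g := fun a b t => hausdorffDist (Φ a b) ((b - a) • Γ t))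
    (fun _ _ _ => hausdorffDist_nonneg) (fun a ha0 ha1 => ?_) ?_ (fun ε hε => ?_) hε
  · have hcwk := hΦ a a ha0 le_rfl ha1
    rw [eq_zero_of_bounded_of_eq_add_self hcwk.1 hcwk.isBounded (hadd a a a ha0 le_rfl le_rfl ha1),
      sub_self, zero_smul_set (hΓ a ⟨ha0, ha1⟩).1]
    exact hausdorffDist_self_zero
  · intro a b c d t u ha hab hb hc hcd hd ht hu
    exact hausdorffDist_smul_le_add (hΦ a b ha hab.le hb) (hΦ c d hc hcd.le hd) (hΓ t ht) (hΓ u hu)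
      (sub_pos.2 hab) (sub_pos.2 hcd)
  · obtain ⟨δ, hδ, H⟩ := hvar ε hε
    exact ⟨δ, hδ, fun s hs => hs.lt_of_forall_TP H⟩


end GaugePaper
end
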